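/- The trivariate Clayton copula density admits the vine (pair-copula) factorization with conditional pair copula Clayton of parameter θ' = θ/(1+θ): for every θ > 0 and all u₁, u₂, u₃ ∈ (0,1), with θ' = θ/(1+θ), c³_θ(u₁,u₂,u₃) = c_θ(u₁,u₃) · c_θ(u₂,u₃) · c_{θ'}(h_θ(u₁,u₃), h_θ(u₂,u₃)), where c_θ and c³_θ are the bivariate and trivariate Clayton copula densities and h_θ is the Clayton h-function. -/

import Mathlib

open Real

/-- The bivariate Clayton copula density
c_θ(u,v) = (1+θ)(uv)^{-(θ+1)} (u^{-θ} + v^{-θ} - 1)^{-(2+1/θ)}. -/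
noncomputable def claytonDensity2 (θ u v : ℝ) : ℝ :=
  (1 + θ) * (u * v) ^ (-(θ+1)) * (u ^ (-θ) + v ^ (-θ) - 1) ^ (-(2+1/θ))

/-- The trivariate Clayton copula density
c³_θ(u₁,u₂,u₃) = (1+θ)(1+2θ)(u₁u₂u₃)^{-(θ+1)} (u₁^{-θ}+u₂^{-θ}+u₃^{-θ}-2)^{-(3+1/θ)}. -/
noncomputable def claytonDensity3 (θ u₁ u₂ u₃ : ℝ) : ℝ :=
  (1 + θ) * (1 + 2*θ) * (u₁ * u₂ * u₃) ^ (-(θ+1))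
    * (u₁ ^ (-θ) + u₂ ^ (-θ) + u₃ ^ (-θ) - 2) ^ (-(3+1/θ))

/-- The Clayton h-function h_θ(u,v) = v^{-(θ+1)} (u^{-θ} + v^{-θ} - 1)^{-(1+1/θ)}. -/
noncomputable def claytonH (θ u v : ℝ) : ℝ :=
  v ^ (-(θ+1)) * (u ^ (-θ) + v ^ (-θ) - 1) ^ (-(1+1/θ))

/-- The generator sum `u^{-θ} + v^{-θ} - 1` is positive on the unit square. -/
theorem clayton_base_pos {θ u v : ℝ} (hθ : 0 < θ) (hu : u ∈ Set.Ioo (0:ℝ) 1)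
    (hv : v ∈ Set.Ioo (0:ℝ) 1) : 0 < u ^ (-θ) + v ^ (-θ) - 1 := by
  have h₁ := one_lt_rpow_of_pos_of_lt_one_of_neg hu.1 hu.2 (neg_lt_zero.mpr hθ)
  have h₂ := one_lt_rpow_of_pos_of_lt_one_of_neg hv.1 hv.2 (neg_lt_zero.mpr hθ)
  linarith

theorem claytonH_pos {θ u v : ℝ} (hθ : 0 < θ) (hu : u ∈ Set.Ioo (0:ℝ) 1)
    (hv : v ∈ Set.Ioo (0:ℝ) 1) : 0 < claytonH θ u v :=
  mul_pos (rpow_pos_of_pos hv.1 _) (rpow_pos_of_pos (clayton_base_pos hθ hu hv) _)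

theorem claytonH_rpow {θ u v : ℝ} (hθ : 0 < θ) (hu : u ∈ Set.Ioo (0:ℝ) 1)
    (hv : v ∈ Set.Ioo (0:ℝ) 1) (x : ℝ) :
    claytonH θ u v ^ x
      = v ^ (-(θ+1) * x) * (u ^ (-θ) + v ^ (-θ) - 1) ^ (-(1+1/θ) * x) := by
  have hA := clayton_base_pos hθ hu hv
  rw [claytonH, mul_rpow (rpow_nonneg hv.1.le _) (rpow_nonneg hA.le _),
    ← rpow_mul hv.1.le, ← rpow_mul hA.le]

/-- In the generator scale of the conditional copula, the h-function is a multiple of `u^{-θ} + v^{-θ} - 1`. -/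
theorem claytonH_rpow_neg {θ u v : ℝ} (hθ : 0 < θ) (hu : u ∈ Set.Ioo (0:ℝ) 1)
    (hv : v ∈ Set.Ioo (0:ℝ) 1) :
    claytonH θ u v ^ (-(θ/(1+θ))) = v ^ θ * (u ^ (-θ) + v ^ (-θ) - 1) := by
  rw [claytonH_rpow hθ hu hv,
    show -(θ+1) * -(θ/(1+θ)) = θ by field_simp; ring,
    show -(1+1/θ) * -(θ/(1+θ)) = 1 by field_simp; ring, rpow_one]

/-- The power of the h-function in the density of the conditional copula. -/
theorem claytonH_rpow_density {θ u v : ℝ} (hθ : 0 < θ) (hu : u ∈ Set.Ioo (0:ℝ) 1)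
    (hv : v ∈ Set.Ioo (0:ℝ) 1) :
    claytonH θ u v ^ (-(θ/(1+θ)+1))
      = v ^ (1+2*θ) * (u ^ (-θ) + v ^ (-θ) - 1) ^ (2+1/θ) := by
  rw [claytonH_rpow hθ hu hv,
    show -(θ+1) * -(θ/(1+θ)+1) = 1+2*θ by field_simp; ring,
    show -(1+1/θ) * -(θ/(1+θ)+1) = 2+1/θ by field_simp; ring]

/-- The trivariate Clayton copula density admits the vine (pair-copula)
factorization, with conditional pair copula Clayton of parameter θ' = θ/(1+θ):
  c³_θ(u₁,u₂,u₃) = c_θ(u₁,u₃) · c_θ(u₂,u₃) · c_{θ'}(h_θ(u₁,u₃), h_θ(u₂,u₃)). -/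
theorem clayton3_vine_factorization
    (θ : ℝ) (hθ : 0 < θ) (u₁ u₂ u₃ : ℝ)
    (hu₁ : u₁ ∈ Set.Ioo (0:ℝ) 1) (hu₂ : u₂ ∈ Set.Ioo (0:ℝ) 1)
    (hu₃ : u₃ ∈ Set.Ioo (0:ℝ) 1) :
    claytonDensity3 θ u₁ u₂ u₃
      = claytonDensity2 θ u₁ u₃ * claytonDensity2 θ u₂ u₃
          * claytonDensity2 (θ/(1+θ)) (claytonH θ u₁ u₃) (claytonH θ u₂ u₃) := by
  have h₁ := hu₁.1
  have h₂ := hu₂.1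
  have h₃ := hu₃.1
  have hA := clayton_base_pos hθ hu₁ hu₃
  have hB := clayton_base_pos hθ hu₂ hu₃
  have hS : 0 < u₁ ^ (-θ) + u₂ ^ (-θ) + u₃ ^ (-θ) - 2 := by
    have := one_lt_rpow_of_pos_of_lt_one_of_neg h₁ hu₁.2 (neg_lt_zero.mpr hθ)
    linarith
  have hc : u₃ ^ θ * u₃ ^ (-θ) = 1 := by rw [← rpow_add h₃, add_neg_cancel, rpow_zero]
  have hsum : u₃ ^ θ * (u₁ ^ (-θ) + u₃ ^ (-θ) - 1) + u₃ ^ θ * (u₂ ^ (-θ) + u₃ ^ (-θ) - 1) - 1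
      = u₃ ^ θ * (u₁ ^ (-θ) + u₂ ^ (-θ) + u₃ ^ (-θ) - 2) := by
    linear_combination hc
  unfold claytonDensity3 claytonDensity2
  rw [mul_rpow (claytonH_pos hθ hu₁ hu₃).le (claytonH_pos hθ hu₂ hu₃).le,
    claytonH_rpow_density hθ hu₁ hu₃, claytonH_rpow_density hθ hu₂ hu₃,
    claytonH_rpow_neg hθ hu₁ hu₃, claytonH_rpow_neg hθ hu₂ hu₃, hsum,
    show -(2+1/(θ/(1+θ))) = -(3+1/θ) by field_simp; ring,
    mul_rpow (rpow_nonneg h₃.le _) hS.le, ← rpow_mul h₃.le,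
    mul_rpow (mul_pos h₁ h₂).le h₃.le, mul_rpow h₁.le h₂.le, mul_rpow h₁.le h₃.le,
    mul_rpow h₂.le h₃.le]
  have hpow : u₃ ^ (-(θ+1)) * u₃ ^ (-(θ+1)) * u₃ ^ (1+2*θ) * u₃ ^ (1+2*θ)
      * u₃ ^ (θ * -(3+1/θ)) = u₃ ^ (-(θ+1)) := by
    simp only [← rpow_add h₃]
    congr 1
    field_simp
    ring
  have hcoef : (1 + θ) * (1 + θ/(1+θ)) = 1 + 2*θ := by field_simp; ring
  rw [rpow_neg hA.le, rpow_neg hB.le]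
  have hA' := (rpow_pos_of_pos hA (2+1/θ)).ne'
  have hB' := (rpow_pos_of_pos hB (2+1/θ)).ne'
  generalize (u₁ ^ (-θ) + u₃ ^ (-θ) - 1) ^ (2+1/θ) = A at *
  generalize (u₂ ^ (-θ) + u₃ ^ (-θ) - 1) ^ (2+1/θ) = B at *
  generalize (u₁ ^ (-θ) + u₂ ^ (-θ) + u₃ ^ (-θ) - 2) ^ (-(3+1/θ)) = S
  have hAA := inv_mul_cancel₀ hA'
  have hBB := inv_mul_cancel₀ hB'
  calc _ = (1 + θ) * ((1 + θ) * (1 + θ/(1+θ))) * (u₁ ^ (-(θ+1)) * u₂ ^ (-(θ+1)))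
        * (u₃ ^ (-(θ+1)) * u₃ ^ (-(θ+1)) * u₃ ^ (1+2*θ) * u₃ ^ (1+2*θ)
          * u₃ ^ (θ * -(3+1/θ))) * S * (A⁻¹ * A) * (B⁻¹ * B) := by
        rw [hpow, hAA, hBB, hcoef]; ring
    _ = _ := by ring1
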